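/- Let 0 ≤ c₂ ≤ c₁, 0 < b₂ ≤ b₁, c₁ ≤ b₂, and c₁c₂ ≤ b₁b₂. Then −8b₁³b₂ + 2b₁b₂c₁c₂ − c₁²c₂² + b₁²(3b₂² − 8b₂c₁ + 8b₂c₂ + 4c₂²) ≤ 0. -/

import Mathlib

theorem stmt_19 (b₁ b₂ c₁ c₂ : ℝ) (hc₂ : 0 ≤ c₂) (hc : c₂ ≤ c₁)
    (hb₂ : 0 < b₂) (hb : b₂ ≤ b₁) (hc₁ : c₁ ≤ b₂) (hcc : c₁ * c₂ ≤ b₁ * b₂) :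
    -8 * b₁ ^ 3 * b₂ + 2 * b₁ * b₂ * c₁ * c₂ - c₁ ^ 2 * c₂ ^ 2
      + b₁ ^ 2 * (3 * b₂ ^ 2 - 8 * b₂ * c₁ + 8 * b₂ * c₂ + 4 * c₂ ^ 2) ≤ 0 := by
  have hb₁ : 0 < b₁ := lt_of_lt_of_le hb₂ hb
  have h1 : 0 ≤ b₁ ^ 2 * (b₂ * (c₁ - c₂)) :=
    mul_nonneg (sq_nonneg _) (mul_nonneg hb₂.le (sub_nonneg.2 hc))
  have h2 : 0 ≤ (b₁ * b₂ - c₁ * c₂) ^ 2 := sq_nonneg _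
  have h3 : 0 ≤ b₁ ^ 2 * ((b₂ - c₂) * (b₂ + c₂)) :=
    mul_nonneg (sq_nonneg _) (mul_nonneg (by linarith) (by linarith))
  have h4 : 0 ≤ b₁ ^ 2 * (b₂ * (b₁ - b₂)) :=
    mul_nonneg (sq_nonneg _) (mul_nonneg hb₂.le (sub_nonneg.2 hb))
  linarith
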